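/- arXiv:2504.14684 — 4 statements merged into one kernel-verified Lean document; each statement's English description precedes it below -/
import Mathlib

section
/- Let d be an odd positive integer, n = d·a for a positive integer a, let J be the standard 2n×2n symplectic matrix, and let x ∈ Sp(2n, ℂ) satisfy x^d = 1. Then the ℂ-dimension of {Y ∈ M_{2n}(ℂ) : Yᵀ J + J Y = 0 and xY = Yx} is at least 2d·a² + a, with equality if and only if the characteristic polynomial of x equals (T^d − 1)^{2a}, i.e. every d-th root of unity is an eigenvalue of x with multiplicity exactly 2a. -/
open Polynomial
open scoped Matrix

/-- The centralizer of `x` in the Lie algebra `{Y : Yᵀ J + J Y = 0}` attached to the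
bilinear form with matrix `J`: the subspace of `Y` with `Yᵀ J + J Y = 0` and `xY = Yx`. -/
noncomputable def lieCentralizer {N : Type*} [Fintype N] [DecidableEq N]
    (J x : Matrix N N ℂ) : Submodule ℂ (Matrix N N ℂ) where
  carrier := {Y | Yᵀ * J + J * Y = 0 ∧ x * Y = Y * x}
  zero_mem' := ⟨by simp, by simp⟩
  add_mem' := by
    intro Y Z hY hZ
    obtain ⟨h1, h2⟩ := hY
    obtain ⟨g1, g2⟩ := hZ
    constructor
    · calc (Y + Z)ᵀ * J + J * (Y + Z)
          = (Yᵀ * J + J * Y) + (Zᵀ * J + J * Z) := by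
            rw [Matrix.transpose_add, Matrix.add_mul, Matrix.mul_add]; abel
        _ = 0 := by rw [h1, g1, add_zero]
    · rw [Matrix.mul_add, Matrix.add_mul, h2, g2]
  smul_mem' := by
    intro c Y hY
    obtain ⟨h1, h2⟩ := hY
    constructor
    · rw [Matrix.transpose_smul, Matrix.smul_mul, Matrix.mul_smul, ← smul_add, h1,
        smul_zero]
    · rw [Matrix.mul_smul, Matrix.smul_mul, h2]

/-- The standard symplectic matrix `J = [[0, 1], [−1, 0]]` of size `2n × 2n`. -/
noncomputable def stdSymplectic (n : ℕ) : Matrix (Fin n ⊕ Fin n) (Fin n ⊕ Fin n) ℂ :=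
  Matrix.fromBlocks 0 1 (-1) 0

open Module Finset

theorem trace_pow_eq_sum_rootMultiplicity_charpoly {N : Type*} [Fintype N] [DecidableEq N]
    {x : Matrix N N ℂ} {d : ℕ} (hd : 0 < d) (hx : x ^ d = 1) (k : ℕ) :
    (x ^ k).trace = ∑ z ∈ nthRootsFinset d (1 : ℂ), (x.charpoly.rootMultiplicity z : ℂ) * z ^ k := by
  set f : Module.End ℂ (N → ℂ) := Matrix.toLin' x with hf
  have hfd : f ^ d = 1 := by
    rw [hf, ← Matrix.toLin'_pow, hx, Matrix.toLin'_one]; rfl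
  have hss : f.IsSemisimple := by
    refine Module.End.isSemisimple_of_squarefree_aeval_eq_zero (p := X ^ d - 1)
      (X_pow_sub_one_separable_iff.mpr (by exact_mod_cast hd.ne')).squarefree ?_
    simp [hfd]
  have hint := DirectSum.isInternal_submodule_of_iSupIndep_of_iSup_eq_top
    f.eigenspaces_iSupIndep hss.iSup_eigenspace_eq_top
  have hmem : ∀ z, f.eigenspace z ≠ ⊥ → z ∈ nthRootsFinset d (1 : ℂ) := by
    intro z hz
    obtain ⟨v, hv, hv0⟩ := (Submodule.ne_bot_iff _).mp hz
    have h1 : (f ^ d) v = z ^ d • v := (show f.HasEigenvector z v from ⟨hv, hv0⟩).pow_apply d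
    rw [hfd, Module.End.one_apply] at h1
    rw [mem_nthRootsFinset hd]
    have h2 : (z ^ d - 1) • v = 0 := by rw [sub_smul, one_smul, ← h1, sub_self]
    exact sub_eq_zero.mp ((smul_eq_zero.mp h2).resolve_right hv0)
  have hfin : {z | f.eigenspace z ≠ ⊥}.Finite :=
    (nthRootsFinset d (1 : ℂ)).finite_toSet.subset fun z hz => hmem z hz
  have hpow : ∀ z, ∀ v ∈ f.eigenspace z, (f ^ k) v = z ^ k • v := by
    intro z v hv
    by_cases hv0 : v = 0
    · simp [hv0]
    · exact (show f.HasEigenvector z v from ⟨hv, hv0⟩).pow_apply k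
  have hmaps : ∀ z, Set.MapsTo (f ^ k : Module.End ℂ (N → ℂ)) (f.eigenspace z) (f.eigenspace z) := by
    intro z v hv
    rw [hpow z v hv]
    exact Submodule.smul_mem _ _ hv
  have hrank : ∀ z, finrank ℂ (f.eigenspace z) = x.charpoly.rootMultiplicity z := by
    intro z
    rw [← hss.isFinitelySemisimple.maxGenEigenspace_eq_eigenspace,
      LinearMap.finrank_maxGenEigenspace_eq, hf, Matrix.charpoly_toLin']
  have htr : ∀ z, LinearMap.trace ℂ (f.eigenspace z) ((f ^ k).restrict (hmaps z)) =
      (x.charpoly.rootMultiplicity z : ℂ) * z ^ k := by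
    intro z
    have : (f ^ k).restrict (hmaps z) = z ^ k • LinearMap.id :=
      LinearMap.ext fun v => Subtype.ext (hpow z v v.2)
    rw [this, map_smul, LinearMap.trace_id, hrank, smul_eq_mul, mul_comm]
  rw [← Matrix.trace_toLin'_eq, Matrix.toLin'_pow, ← hf,
    LinearMap.trace_eq_sum_trace_restrict' hint hfin hmaps]
  simp_rw [htr]
  refine Finset.sum_subset (fun z hz => hmem z (by simpa using hz)) fun z _ hz => ?_
  have hz' : f.eigenspace z = ⊥ := by simpa using hz
  rw [← hrank, hz', finrank_bot]; simp

theorem charpoly_eq_prod_nthRootsFinset {N : Type*} [Fintype N] [DecidableEq N]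
    {x : Matrix N N ℂ} {d : ℕ} (hd : 0 < d) (hx : x ^ d = 1) :
    x.charpoly = ∏ z ∈ nthRootsFinset d (1 : ℂ), (X - C z) ^ x.charpoly.rootMultiplicity z := by
  have hmem : x.charpoly.roots.toFinset ⊆ nthRootsFinset d (1 : ℂ) := by
    intro z hz
    rw [Multiset.mem_toFinset, mem_roots x.charpoly_monic.ne_zero] at hz
    have h1 := spectrum.pow_mem_pow x d (Matrix.mem_spectrum_of_isRoot_charpoly hz)
    rw [hx] at h1
    rw [mem_nthRootsFinset hd]
    cases isEmpty_or_nonempty N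
    · simp at hz
    · simpa using h1
  conv_lhs => rw [(IsAlgClosed.splits x.charpoly).eq_prod_roots_of_monic x.charpoly_monic,
    Finset.prod_multiset_map_count]
  simp_rw [count_roots]
  refine Finset.prod_subset hmem fun z _ hz => ?_
  rw [Multiset.mem_toFinset, ← Multiset.count_eq_zero, count_roots] at hz
  rw [hz, pow_zero]

theorem charpoly_eq_X_pow_sub_one_pow_iff {N : Type*} [Fintype N] [DecidableEq N]
    {x : Matrix N N ℂ} {d : ℕ} (hd : 0 < d) (hx : x ^ d = 1) (b : ℕ) :
    x.charpoly = ((X : ℂ[X]) ^ d - 1) ^ b ↔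
      ∀ z ∈ nthRootsFinset d (1 : ℂ), x.charpoly.rootMultiplicity z = b := by
  have hprim := Complex.isPrimitiveRoot_exp d hd.ne'
  constructor
  · intro h z hz
    rw [h, ← count_roots, roots_pow, Multiset.count_nsmul,
      ← C_1, ← nthRoots, Multiset.count_eq_one_of_mem hprim.nthRoots_one_nodup, mul_one]
    rwa [mem_nthRoots hd, ← mem_nthRootsFinset hd]
  · intro h
    rw [charpoly_eq_prod_nthRootsFinset hd hx, X_pow_sub_one_eq_prod hd hprim, ← Finset.prod_pow]
    exact Finset.prod_congr rfl fun z hz => by rw [h z hz]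

theorem sum_rootMultiplicity_charpoly {N : Type*} [Fintype N] [DecidableEq N]
    {x : Matrix N N ℂ} {d : ℕ} (hd : 0 < d) (hx : x ^ d = 1) :
    ∑ z ∈ nthRootsFinset d (1 : ℂ), x.charpoly.rootMultiplicity z = Fintype.card N := by
  rw [← x.charpoly_natDegree_eq_dim]
  conv_rhs => rw [charpoly_eq_prod_nthRootsFinset hd hx]
  rw [natDegree_prod_of_monic _ _ fun z _ => (monic_X_sub_C z).pow _]
  simp

theorem Matrix.stdBasis_repr_apply {N : Type*} [Fintype N] (M : Matrix N N ℂ) (i j : N) :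
    (Matrix.stdBasis ℂ N N).repr M (i, j) = M i j := by
  simp [Matrix.stdBasis]

theorem Matrix.mul_single_mul_apply {N : Type*} [Fintype N] [DecidableEq N]
    (A B : Matrix N N ℂ) (i j k l : N) :
    (A * Matrix.single i j (1 : ℂ) * B) k l = A k i * B j l := by
  rw [Matrix.mul_apply, Finset.sum_eq_single j]
  · simp
  · intro b _ hb
    simp [Matrix.mul_single_apply_of_ne _ _ _ _ _ hb]
  · simp

theorem Matrix.trace_mulLeft_comp_mulRight {N : Type*} [Fintype N] [DecidableEq N]
    (A B : Matrix N N ℂ) :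
    LinearMap.trace ℂ _ (LinearMap.mulLeft ℂ A ∘ₗ LinearMap.mulRight ℂ B) = A.trace * B.trace := by
  rw [LinearMap.trace_eq_matrix_trace ℂ (Matrix.stdBasis ℂ N N), Matrix.trace, Fintype.sum_prod_type,
    Matrix.trace, Matrix.trace, Finset.sum_mul_sum]
  refine Finset.sum_congr rfl fun i _ => Finset.sum_congr rfl fun j _ => ?_
  rw [Matrix.diag_apply, LinearMap.toMatrix_apply, Matrix.stdBasis_eq_single]
  rw [Matrix.stdBasis_repr_apply, LinearMap.comp_apply, LinearMap.mulRight_apply,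
    LinearMap.mulLeft_apply, ← mul_assoc, Matrix.mul_single_mul_apply,
    Matrix.diag_apply, Matrix.diag_apply]

theorem Matrix.trace_mulLeft_comp_mulRight_comp_transpose {N : Type*} [Fintype N] [DecidableEq N]
    (A B : Matrix N N ℂ) :
    LinearMap.trace ℂ _ (LinearMap.mulLeft ℂ A ∘ₗ LinearMap.mulRight ℂ B ∘ₗ
      (Matrix.transposeLinearEquiv N N ℂ ℂ).toLinearMap) = (A * Bᵀ).trace := by
  rw [LinearMap.trace_eq_matrix_trace ℂ (Matrix.stdBasis ℂ N N), Matrix.trace, Fintype.sum_prod_type,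
    Matrix.trace]
  refine Finset.sum_congr rfl fun i _ => ?_
  rw [Matrix.diag_apply, Matrix.mul_apply]
  refine Finset.sum_congr rfl fun j _ => ?_
  rw [Matrix.diag_apply, LinearMap.toMatrix_apply, Matrix.stdBasis_eq_single]
  rw [Matrix.stdBasis_repr_apply]
  change (A * ((Matrix.single i j (1 : ℂ))ᵀ * B)) i j = _
  rw [Matrix.transpose_single, ← mul_assoc, Matrix.mul_single_mul_apply, Matrix.transpose_apply]

theorem sum_range_pow_of_pow_eq_one {d : ℕ} {z : ℂ} (hz : z ^ d = 1) :
    ∑ k ∈ range d, z ^ k = if z = 1 then (d : ℂ) else 0 := by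
  split_ifs with h
  · simp [h]
  · rw [geom_sum_eq h, hz, sub_self, zero_div]

theorem two_mul_finrank_lieCentralizer {N : Type*} [Fintype N] [DecidableEq N]
    {J x y : Matrix N N ℂ} {d : ℕ} (hd : 0 < d) (hJ : J * J = -1) (hJt : Jᵀ = -J)
    (hsp : xᵀ * J * x = J) (hx : x ^ d = 1) (hxy : x * y = 1) :
    (2 * d * finrank ℂ (lieCentralizer J x) : ℂ) =
      ∑ k ∈ range d, (x ^ k).trace * (y ^ k).trace + ∑ k ∈ range d, (x ^ (2 * k)).trace := by
  have hyx : y * x = 1 := mul_eq_one_comm.mp hxy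
  have hy : y ^ d = 1 := by
    have := (Commute.mul_pow (show Commute x y by rw [Commute, SemiconjBy, hxy, hyx]) d)
    rwa [hxy, one_pow, hx, one_mul, eq_comm] at this
  have hxJ : xᵀ * J = J * y := by
    calc xᵀ * J = xᵀ * J * x * y := by rw [mul_assoc _ x, hxy, mul_one]
      _ = _ := by rw [hsp]
  have hJx : J * x = yᵀ * J := by
    have := congrArg Matrix.transpose hxJ
    simpa [hJt] using this
  have hJy : J * yᵀ = x * J := by
    calc J * yᵀ = -(J * (yᵀ * J) * J) := by simp only [mul_assoc, hJ]; simp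
      _ = x * J := by rw [← hJx, ← mul_assoc, hJ]; simp
  have hxJk (k : ℕ) : (x ^ k)ᵀ * J = J * y ^ k := by
    rw [Matrix.transpose_pow]
    exact ((show SemiconjBy J y xᵀ from hxJ.symm).pow_right k).eq.symm
  have hJyk (k : ℕ) : J * (y ^ k)ᵀ = x ^ k * J := by
    rw [Matrix.transpose_pow]
    exact ((show SemiconjBy J yᵀ x from hJy).pow_right k).eq
  have hxyk (k : ℕ) : x ^ k * y ^ k = 1 := by
    rw [← (show Commute x y by rw [Commute, SemiconjBy, hxy, hyx]).mul_pow, hxy, one_pow]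
  -- `P` averages over the cyclic group and over the involution `Y ↦ J Yᵀ J`.
  set P : Matrix N N ℂ →ₗ[ℂ] Matrix N N ℂ := (2 * d : ℂ)⁻¹ • (∑ k ∈ range d,
    LinearMap.mulLeft ℂ (x ^ k) ∘ₗ LinearMap.mulRight ℂ (y ^ k) + ∑ k ∈ range d,
    LinearMap.mulLeft ℂ (x ^ k * J) ∘ₗ LinearMap.mulRight ℂ (J * y ^ k) ∘ₗ
      (Matrix.transposeLinearEquiv N N ℂ ℂ).toLinearMap) with hP
  have hd' : (2 * d : ℂ) ≠ 0 := by
    have : (d : ℂ) ≠ 0 := by exact_mod_cast hd.ne'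
    simp [this]
  have hPapp (Y : Matrix N N ℂ) : P Y = (2 * d : ℂ)⁻¹ •
      ∑ k ∈ range d, x ^ k * (Y + J * Yᵀ * J) * y ^ k := by
    simp [hP, mul_add, add_mul, Finset.sum_add_distrib, mul_assoc]
  have hproj : LinearMap.IsProj (lieCentralizer J x) P := by
    constructor
    · intro Y
      rw [hPapp]
      refine Submodule.smul_mem _ _ ⟨?_, ?_⟩
      · rw [Matrix.transpose_sum, Finset.sum_mul, Finset.mul_sum, ← Finset.sum_add_distrib]
        refine Finset.sum_eq_zero fun k _ => ?_
        set Z := Y + J * Yᵀ * J with hZ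
        have hZJ : Zᵀ * J = - (J * Z) := by
          simp only [hZ, Matrix.transpose_add, Matrix.transpose_mul, hJt, add_mul, mul_add,
            Matrix.transpose_transpose, ← mul_assoc, hJ]
          simp only [mul_assoc, hJ, neg_mul, mul_neg, neg_neg]
          simp
        have e : J * (J * (y ^ k)ᵀ) = J * (x ^ k * J) := by rw [hJyk]
        rw [← mul_assoc, hJ] at e
        have e' : (y ^ k)ᵀ = - (J * (x ^ k * J)) := by rw [← e]; simp
        calc (x ^ k * Z * y ^ k)ᵀ * J + J * (x ^ k * Z * y ^ k)
            = (y ^ k)ᵀ * (Zᵀ * ((x ^ k)ᵀ * J)) + J * (x ^ k * Z * y ^ k) := by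
              simp only [Matrix.transpose_mul, mul_assoc]
          _ = (y ^ k)ᵀ * (Zᵀ * J) * y ^ k + J * (x ^ k * Z * y ^ k) := by
              rw [hxJk]; simp only [mul_assoc]
          _ = J * x ^ k * (J * J) * Z * y ^ k + J * (x ^ k * Z * y ^ k) := by
              rw [hZJ, e']; simp only [mul_assoc, neg_mul, mul_neg, neg_neg]
          _ = 0 := by rw [hJ]; simp [mul_assoc]
      · set Z := Y + J * Yᵀ * J
        have hshift : x * (∑ k ∈ range d, x ^ k * Z * y ^ k) * y =
            ∑ k ∈ range d, x ^ k * Z * y ^ k := by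
          rw [Finset.mul_sum, Finset.sum_mul]
          have h1 := Finset.sum_range_succ (fun k => x ^ k * Z * y ^ k) d
          rw [Finset.sum_range_succ', hx, hy, pow_zero, pow_zero] at h1
          rw [← add_right_cancel h1]
          refine Finset.sum_congr rfl fun k _ => ?_
          rw [pow_succ', pow_succ]
          simp only [mul_assoc]
        calc _ = x * (∑ k ∈ range d, x ^ k * Z * y ^ k) * y * x := by
              rw [mul_assoc _ y x, hyx, mul_one]
          _ = _ := by rw [hshift]
    · rintro Y ⟨h1, h2⟩
      have h3 : J * Yᵀ * J = Y := by
        rw [mul_assoc, eq_neg_of_add_eq_zero_left h1, mul_neg, ← mul_assoc, hJ]; simp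
      have h4 (k : ℕ) : x ^ k * (Y + Y) * y ^ k = (2 : ℂ) • Y := by
        have : Commute (x ^ k) (Y + Y) :=
          ((show Commute x Y from h2).add_right (show Commute x Y from h2)).pow_left k
        rw [this.eq, mul_assoc, hxyk, mul_one, two_smul]
      rw [hPapp, h3]
      simp_rw [h4]
      rw [Finset.sum_const, card_range, ← Nat.cast_smul_eq_nsmul ℂ, smul_smul, smul_smul,
        mul_assoc, mul_comm (d : ℂ), inv_mul_cancel₀ hd', one_smul]
  rw [← hproj.trace, hP, map_smul, smul_eq_mul, mul_inv_cancel_left₀ hd', map_add, map_sum, map_sum]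
  congr 1
  · exact Finset.sum_congr rfl fun k _ => Matrix.trace_mulLeft_comp_mulRight _ _
  · refine Finset.sum_congr rfl fun k _ => ?_
    rw [Matrix.trace_mulLeft_comp_mulRight_comp_transpose]
    congr 1
    rw [Matrix.transpose_mul, hJt, mul_neg, mul_neg, mul_assoc, ← mul_assoc J, hJyk, mul_assoc, hJ,
      two_mul, pow_add]
    simp

theorem two_mul_finrank_lieCentralizer_eq_sum_sq {N : Type*} [Fintype N] [DecidableEq N]
    {J x : Matrix N N ℂ} {d : ℕ} (hd : Odd d) (hJ : J * J = -1) (hJt : Jᵀ = -J)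
    (hsp : xᵀ * J * x = J) (hx : x ^ d = 1) :
    2 * finrank ℂ (lieCentralizer J x) =
      ∑ z ∈ nthRootsFinset d (1 : ℂ), x.charpoly.rootMultiplicity z ^ 2 +
        x.charpoly.rootMultiplicity 1 := by
  have hd0 : (d : ℂ) ≠ 0 := by exact_mod_cast hd.pos.ne'
  have hxy : x * x ^ (d - 1) = 1 := by rw [← pow_succ', Nat.sub_add_cancel hd.pos, hx]
  have key := two_mul_finrank_lieCentralizer hd.pos hJ hJt hsp hx hxy
  set U := nthRootsFinset d (1 : ℂ) with hU
  set m : ℂ → ℕ := fun z => x.charpoly.rootMultiplicity z with hm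
  have hUd {z : ℂ} (hz : z ∈ U) : z ^ d = 1 := (mem_nthRootsFinset hd.pos _).mp hz
  have tr (k : ℕ) : (x ^ k).trace = ∑ z ∈ U, (m z : ℂ) * z ^ k :=
    trace_pow_eq_sum_rootMultiplicity_charpoly hd.pos hx k
  have h1 : ∑ k ∈ range d, (x ^ k).trace * ((x ^ (d - 1)) ^ k).trace =
      d * ∑ z ∈ U, (m z : ℂ) ^ 2 := by
    simp_rw [← pow_mul, tr, Finset.sum_mul_sum]
    rw [Finset.sum_comm, Finset.mul_sum]
    refine Finset.sum_congr rfl fun z hz => ?_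
    rw [Finset.sum_comm]
    have hw : ∀ w ∈ U, ∑ k ∈ range d, (m z : ℂ) * z ^ k * (m w * w ^ ((d - 1) * k)) =
        if z = w then (d : ℂ) * (m z) ^ 2 else 0 := by
      intro w hw
      have hinv : w ^ (d - 1) * w = 1 := by
        rw [← pow_succ, Nat.sub_add_cancel hd.pos, hUd hw]
      have hiff : z * w ^ (d - 1) = 1 ↔ z = w := by
        constructor
        · intro h
          calc z = z * w ^ (d - 1) * w := by rw [mul_assoc, hinv, mul_one]
            _ = w := by rw [h, one_mul]
        · rintro rfl; rw [mul_comm, hinv]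
      have hpow : (z * w ^ (d - 1)) ^ d = 1 := by
        rw [mul_pow, ← pow_mul, mul_comm (d - 1), pow_mul, hUd hz, hUd hw]; simp
      calc _ = ∑ k ∈ range d, (m z * m w : ℂ) * (z * w ^ (d - 1)) ^ k :=
            Finset.sum_congr rfl fun k _ => by rw [mul_pow, ← pow_mul]; ring
        _ = _ := by
          rw [← Finset.mul_sum, sum_range_pow_of_pow_eq_one hpow]
          simp only [hiff]
          split_ifs with h
          · rw [h]; ring
          · simp
    rw [Finset.sum_congr rfl hw, Finset.sum_ite_eq, if_pos hz]
  have h2 : ∑ k ∈ range d, (x ^ (2 * k)).trace = d * m 1 := by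
    simp_rw [tr]
    rw [Finset.sum_comm]
    have hz : ∀ z ∈ U, ∑ k ∈ range d, (m z : ℂ) * z ^ (2 * k) =
        if 1 = z then (d : ℂ) * m z else 0 := by
      intro z hz
      have hiff : z ^ 2 = 1 ↔ 1 = z := by
        constructor
        · intro h
          obtain ⟨e, rfl⟩ := hd
          have := hUd hz
          rw [pow_succ, pow_mul, h, one_pow, one_mul] at this
          exact this.symm
        · rintro rfl; simp
      have hpow : (z ^ 2) ^ d = 1 := by rw [← pow_mul, mul_comm, pow_mul, hUd hz, one_pow]
      simp_rw [pow_mul]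
      rw [← Finset.mul_sum, sum_range_pow_of_pow_eq_one hpow]
      simp only [hiff]
      split_ifs <;> ring
    rw [Finset.sum_congr rfl hz, Finset.sum_ite_eq, if_pos (one_mem_nthRootsFinset hd.pos)]
  rw [h1, h2, ← mul_add, mul_comm (2 : ℂ), mul_assoc] at key
  exact_mod_cast mul_left_cancel₀ hd0 key

theorem sum_sq_add_bound {ι : Type*} {U : Finset ι} {i₀ : ι} (hi₀ : i₀ ∈ U) (m : ι → ℕ) (a : ℕ)
    (hm : ∑ i ∈ U, m i = #U * (2 * a)) :
    4 * #U * a ^ 2 + 2 * a ≤ ∑ i ∈ U, m i ^ 2 + m i₀ ∧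
    (∑ i ∈ U, m i ^ 2 + m i₀ = 4 * #U * a ^ 2 + 2 * a ↔ ∀ i ∈ U, m i = 2 * a) := by
  classical
  set e : ι → ℤ := fun i => m i - 2 * a with he
  have hsum : ∑ i ∈ U, e i = 0 := by
    have : (∑ i ∈ U, (m i : ℤ)) = #U * (2 * a) := by exact_mod_cast hm
    simp [he, Finset.sum_sub_distrib, this]
  have hsq : (∑ i ∈ U, (m i : ℤ) ^ 2) + m i₀ =
      4 * #U * a ^ 2 + 2 * a + (∑ i ∈ U, e i ^ 2 + e i₀) := by
    have h1 : ∀ i ∈ U, (m i : ℤ) ^ 2 = e i ^ 2 + 4 * a * e i + 4 * a ^ 2 := fun i _ => by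
      simp only [he]; ring
    rw [Finset.sum_congr rfl h1, Finset.sum_add_distrib, Finset.sum_add_distrib, ← Finset.mul_sum,
      hsum, Finset.sum_const, nsmul_eq_mul]
    simp only [he]; ring
  have hsplit : ∑ i ∈ U, e i ^ 2 + e i₀ = ∑ i ∈ U.erase i₀, e i ^ 2 + (e i₀ ^ 2 + e i₀) := by
    rw [← Finset.sum_erase_add _ _ hi₀, add_assoc]
  have hn1 : 0 ≤ ∑ i ∈ U.erase i₀, e i ^ 2 := Finset.sum_nonneg fun i _ => sq_nonneg _
  have hn2 : 0 ≤ e i₀ ^ 2 + e i₀ := by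
    rcases le_or_gt 0 (e i₀) with h | h <;> nlinarith
  refine ⟨by zify; linarith, ?_, ?_⟩
  · intro h
    zify at h
    have hz : ∑ i ∈ U.erase i₀, e i ^ 2 = 0 := by linarith
    rw [Finset.sum_eq_zero_iff_of_nonneg fun i _ => sq_nonneg _] at hz
    have hz' : ∀ i ∈ U.erase i₀, e i = 0 := fun i hi => pow_eq_zero_iff two_ne_zero |>.mp (hz i hi)
    have h0 : e i₀ = 0 := by
      rw [← Finset.sum_erase_add _ _ hi₀, Finset.sum_eq_zero hz', zero_add] at hsum
      exact hsum
    intro i hi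
    have : e i = 0 := by
      by_cases hii : i = i₀
      · rw [hii, h0]
      · exact hz' i (Finset.mem_erase.mpr ⟨hii, hi⟩)
    simp only [he] at this
    omega
  · intro h
    rw [h i₀ hi₀, Finset.sum_congr rfl fun i hi => by rw [h i hi], Finset.sum_const, smul_eq_mul]
    ring

/-- let `d` be odd, `n = d·a` (`a ≥ 1`), and let `x ∈ Sp(2n, ℂ)` (i.e.
`xᵀ J x = J`) satisfy `x^d = 1`.  Then the centralizer of `x` in `𝔰𝔭_{2n}(ℂ)` has
dimension at least `2d·a² + a`, with equality iff the characteristic polynomial of `x` is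
`(T^d − 1)^{2a}`. -/
theorem sp_centralizer_dim_ge_of_odd_order {n d a : ℕ} (hd : Odd d) (hdpos : 0 < d)
    (ha : 0 < a) (hn : n = d * a) (x : Matrix (Fin n ⊕ Fin n) (Fin n ⊕ Fin n) ℂ)
    (hsp : xᵀ * stdSymplectic n * x = stdSymplectic n)
    (hx : x ^ d = 1) :
    2 * d * a ^ 2 + a ≤ Module.finrank ℂ (lieCentralizer (stdSymplectic n) x) ∧
    (Module.finrank ℂ (lieCentralizer (stdSymplectic n) x) = 2 * d * a ^ 2 + a ↔
      x.charpoly = ((X : ℂ[X]) ^ d - 1) ^ (2 * a)) := by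
  have hJ : stdSymplectic n * stdSymplectic n = -1 := by
    rw [stdSymplectic, Matrix.fromBlocks_multiply, ← Matrix.fromBlocks_one, Matrix.fromBlocks_neg]
    simp
  have hJt : (stdSymplectic n)ᵀ = -stdSymplectic n := by
    simp [stdSymplectic, Matrix.fromBlocks_transpose, Matrix.fromBlocks_neg]
  have hcard := (Complex.isPrimitiveRoot_exp d hdpos.ne').card_nthRootsFinset
  have hsum := sum_rootMultiplicity_charpoly hdpos hx
  obtain ⟨h1, h2⟩ := sum_sq_add_bound (one_mem_nthRootsFinset hdpos)
    (fun z => x.charpoly.rootMultiplicity z) a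
    (by rw [hsum, hcard, Fintype.card_sum, Fintype.card_fin, hn]; ring)
  rw [← two_mul_finrank_lieCentralizer_eq_sum_sq hd hJ hJt hsp hx, hcard] at h1 h2
  refine ⟨by linarith, ?_⟩
  rw [charpoly_eq_X_pow_sub_one_pow_iff hdpos hx, ← h2]
  constructor <;> intro h <;> linarith
end

section
/- Let d ≥ 3 be an odd integer dividing n, and set m = n/d. Consider elements of SO_{2n+2}(ℂ) of order dividing d. There exist x₁, x₂ ∈ SO_{2n+2}(ℂ) with x₁^d = x₂^d = 1 such that: (i) the characteristic polynomial of x₁ is (T^d − 1)^{2m}·(T − 1)², (ii) the characteristic polynomial of x₂ is (T^d − 1)^{2m}·(T − ζ)(T − ζ^{−1}) for ζ a fixed primitive d-th root of unity, (iii) the centralizers of x₁ and x₂ in 𝔰𝔬_{2n+2}(ℂ) both have ℂ-dimension 2d·m² + 3m + 1, and this is the minimum of the centralizer dimension over all x ∈ SO_{2n+2}(ℂ) with x^d = 1, and (iv) x₁ and x₂ are not conjugate (they have different characteristic polynomials). Thus for odd d ≥ 3 dividing the Coxeter number 2n of SO_{2n+2}(ℂ), the minimal centralizer dimension among order-d elements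 is attained by exactly two non-conjugate classes, one of which is the principal element C_d. -/
open Polynomial
open scoped Matrix

/-- The centralizer of `x` in the orthogonal Lie algebra `𝔰𝔬_N(ℂ) = {Y : Yᵀ = −Y}`:
the subspace of antisymmetric matrices commuting with `x`. -/
noncomputable def soCentralizer {N : Type*} [Fintype N] [DecidableEq N]
    (x : Matrix N N ℂ) : Submodule ℂ (Matrix N N ℂ) where
  carrier := {Y | Yᵀ = -Y ∧ x * Y = Y * x}
  zero_mem' := ⟨by simp, by simp⟩
  add_mem' := by
    intro Y Z hY hZ
    obtain ⟨h1, h2⟩ := hY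
    obtain ⟨g1, g2⟩ := hZ
    constructor
    · rw [Matrix.transpose_add, h1, g1, neg_add]
    · rw [Matrix.mul_add, Matrix.add_mul, h2, g2]
  smul_mem' := by
    intro c Y hY
    obtain ⟨h1, h2⟩ := hY
    constructor
    · rw [Matrix.transpose_smul, h1, smul_neg]
    · rw [Matrix.mul_smul, Matrix.smul_mul, h2]

/-- The map `Y ↦ ∑ j, E j * ((Y - Yᵀ) / 2) * E j`, compressing the antisymmetric part of `Y`. -/
noncomputable def antisymmPinching {N ι : Type*} [Fintype N] [Fintype ι]
    (E : ι → Matrix N N ℂ) : Matrix N N ℂ →ₗ[ℂ] Matrix N N ℂ where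
  toFun Y := (2⁻¹ : ℂ) • ∑ j, E j * (Y - Yᵀ) * E j
  map_add' Y Z := by
    rw [← smul_add, ← Finset.sum_add_distrib]
    congr 1
    refine Finset.sum_congr rfl fun j _ => ?_
    rw [Matrix.transpose_add, ← add_mul, ← mul_add]
    congr 2
    abel
  map_smul' c Y := by
    rw [RingHom.id_apply, smul_comm c (2⁻¹ : ℂ)]
    congr 1
    rw [Finset.smul_sum]
    refine Finset.sum_congr rfl fun j _ => ?_
    rw [Matrix.transpose_smul, ← smul_sub, Matrix.mul_smul, Matrix.smul_mul]

theorem trace_antisymmPinching {N ι : Type*} [Fintype N] [DecidableEq N] [Fintype ι]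
    (E : ι → Matrix N N ℂ) :
    LinearMap.trace ℂ _ (antisymmPinching E) =
      2⁻¹ * ∑ j, ((E j).trace ^ 2 - (E j * (E j)ᵀ).trace) := by
  have key (j : ι) (a b : N) :
      (E j * (Matrix.single a b 1 - (Matrix.single a b 1)ᵀ) * E j : Matrix N N ℂ) a b =
        E j a a * E j b b - E j a b * E j a b := by
    rw [Matrix.transpose_single, mul_sub, sub_mul, Matrix.sub_apply]
    simp [Matrix.mul_apply, Matrix.single_apply, Finset.sum_ite_eq, ite_and]
  rw [LinearMap.trace_eq_matrix_trace ℂ (Matrix.stdBasis ℂ N N), Matrix.trace]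
  have hdiag (p : N × N) :
      (LinearMap.toMatrix (Matrix.stdBasis ℂ N N) (Matrix.stdBasis ℂ N N)
        (antisymmPinching E)).diag p =
      2⁻¹ * ∑ j, (E j p.1 p.1 * E j p.2 p.2 - E j p.1 p.2 * E j p.1 p.2) := by
    obtain ⟨a, b⟩ := p
    rw [Matrix.diag_apply, LinearMap.toMatrix_apply, Matrix.stdBasis_eq_single]
    have hrepr (M : Matrix N N ℂ) : (Matrix.stdBasis ℂ N N).repr M (a, b) = M a b := by
      simp [Matrix.stdBasis]
    rw [hrepr]
    simp only [antisymmPinching, LinearMap.coe_mk, AddHom.coe_mk, Matrix.smul_apply, smul_eq_mul,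
      Matrix.sum_apply, key]
  simp_rw [hdiag]
  rw [← Finset.mul_sum, Finset.sum_comm]
  congr 1
  refine Finset.sum_congr rfl fun j _ => ?_
  rw [Fintype.sum_prod_type]
  simp only [Finset.sum_sub_distrib, Matrix.trace, Matrix.diag_apply, Matrix.mul_apply,
    Matrix.transpose_apply, sq, Finset.sum_mul_sum]

theorem Matrix.exists_trace_eq_natCast_of_isIdempotentElem {N : Type*} [Fintype N] [DecidableEq N]
    {E : Matrix N N ℂ} (hE : E * E = E) : ∃ a : ℕ, E.trace = a := by
  have h : IsIdempotentElem (Matrix.toLin' E) := by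
    rw [IsIdempotentElem, Module.End.mul_eq_comp, ← Matrix.toLin'_mul, hE]
  have h2 := (LinearMap.IsProj.trace (LinearMap.isProj_range_iff_isIdempotentElem _ |>.mpr h))
  rw [Matrix.trace_toLin'_eq] at h2
  exact ⟨_, h2⟩

theorem ZMod.eq_neg_self_iff_of_odd (hd : Odd d) (j : ZMod d) : j = -j ↔ j = 0 := by
  rw [eq_comm, ZMod.neg_eq_self_iff]
  constructor
  · rintro (h | h)
    · exact h
    · exact absurd hd (by rw [Nat.not_odd_iff_even]; exact ⟨j.val, by omega⟩)
  · exact Or.inl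

section SpectralProjection

variable {N : Type*} [Fintype N] [DecidableEq N] {d : ℕ} [NeZero d]

/-- For `x ^ d = 1`, the projection onto the eigenspace of `x` with eigenvalue `ψ j`. -/
noncomputable def spectralProj (ψ : AddChar (ZMod d) ℂ) (x : Matrix N N ℂ) (j : ZMod d) :
    Matrix N N ℂ :=
  (d : ℂ)⁻¹ • ∑ k : ZMod d, ψ (-(j * k)) • x ^ k.val

theorem pow_val_mul_pow_val {M : Type*} [Monoid M] {x : M} (hx : x ^ d = 1) (k l : ZMod d) :
    x ^ k.val * x ^ l.val = x ^ (k + l).val := by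
  rw [← pow_add, pow_eq_pow_mod _ hx, ZMod.val_add]

variable {ψ : AddChar (ZMod d) ℂ} {x : Matrix N N ℂ}

theorem sum_spectralProj (hψ : ψ.IsPrimitive) : ∑ j, spectralProj ψ x j = 1 := by
  have hd : (d : ℂ) ≠ 0 := NeZero.ne _
  simp only [spectralProj]
  rw [← Finset.smul_sum, Finset.sum_comm]
  have h (k : ZMod d) : ∑ j, ψ (-(j * k)) • x ^ k.val = if k = 0 then (d : ℂ) • 1 else 0 := by
    rw [← Finset.sum_smul]
    simp_rw [← mul_neg]
    rw [AddChar.sum_mulShift _ hψ]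
    simp only [neg_eq_zero, ZMod.card]
    split_ifs with h <;> simp [h]
  simp [h, hd]

theorem transpose_spectralProj (hx : xᵀ * x = 1) (hxd : x ^ d = 1) (j : ZMod d) :
    (spectralProj ψ x j)ᵀ = spectralProj ψ x (-j) := by
  have h (k : ZMod d) : (x ^ k.val)ᵀ = x ^ (-k).val := by
    have h1 : (x ^ k.val)ᵀ * x ^ k.val = 1 := by
      have hcomm : Commute xᵀ x := hx.trans (mul_eq_one_comm.mp hx).symm
      rw [Matrix.transpose_pow, ← hcomm.mul_pow, hx, one_pow]
    have h2 : x ^ k.val * x ^ (-k).val = 1 := by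
      rw [pow_val_mul_pow_val hxd, add_neg_cancel, ZMod.val_zero, pow_zero]
    exact left_inv_eq_right_inv h1 h2
  simp only [spectralProj, Matrix.transpose_smul, Matrix.transpose_sum, h]
  congr 1
  rw [← Equiv.sum_comp (Equiv.neg (ZMod d))]
  simp

theorem pow_mul_spectralProj (hxd : x ^ d = 1) (k j : ZMod d) :
    x ^ k.val * spectralProj ψ x j = ψ (j * k) • spectralProj ψ x j := by
  simp only [spectralProj]
  rw [Matrix.mul_smul, smul_comm (ψ (j * k))]
  congr 1
  rw [Finset.mul_sum, Finset.smul_sum]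
  rw [← Equiv.sum_comp (Equiv.addLeft k) (fun l => ψ (j * k) • ψ (-(j * l)) • x ^ l.val)]
  refine Finset.sum_congr rfl fun l _ => ?_
  rw [Matrix.mul_smul, pow_val_mul_pow_val hxd, smul_smul, ← AddChar.map_add_eq_mul]
  simp only [Equiv.coe_addLeft]
  congr 2
  ring

theorem spectralProj_mul_spectralProj (hψ : ψ.IsPrimitive) (hxd : x ^ d = 1) (i j : ZMod d) :
    spectralProj ψ x i * spectralProj ψ x j = if i = j then spectralProj ψ x j else 0 := by
  have hd : (d : ℂ) ≠ 0 := NeZero.ne _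
  conv_lhs => rw [spectralProj]
  simp_rw [Matrix.smul_mul, Finset.sum_mul, Matrix.smul_mul, pow_mul_spectralProj hxd, smul_smul,
    ← AddChar.map_add_eq_mul, ← Finset.sum_smul]
  have h (k : ZMod d) : -(i * k) + j * k = k * (j - i) := by ring
  simp_rw [h]
  rw [AddChar.sum_mulShift _ hψ, ZMod.card]
  by_cases hij : i = j
  · simp [hij, hd]
  · simp [hij, sub_eq_zero, Ne.symm hij]

theorem commute_spectralProj {Y : Matrix N N ℂ} (h : Commute x Y) (j : ZMod d) :
    Commute (spectralProj ψ x j) Y :=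
  (Commute.sum_left _ _ _ fun k _ => (h.pow_left k.val).smul_left _).smul_left _

theorem isProj_antisymmPinching (hψ : ψ.IsPrimitive) (hx : xᵀ * x = 1) (hxd : x ^ d = 1) :
    LinearMap.IsProj (soCentralizer x) (antisymmPinching (spectralProj ψ x)) where
  map_mem Y := by
    refine ⟨?_, ?_⟩
    · simp only [antisymmPinching, LinearMap.coe_mk, AddHom.coe_mk, Matrix.transpose_smul,
        Matrix.transpose_sum, Matrix.transpose_mul, transpose_spectralProj hx hxd]
      rw [← smul_neg, ← Finset.sum_neg_distrib, ← Equiv.sum_comp (Equiv.neg (ZMod d))]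
      simp only [Equiv.neg_apply, neg_neg, Matrix.transpose_sub, Matrix.transpose_transpose]
      congr 1
      refine Finset.sum_congr rfl fun j _ => ?_
      noncomm_ring
    · have hc (j : ZMod d) : x * spectralProj ψ x j = ψ j • spectralProj ψ x j := by
        have h1 : x ^ (1 : ZMod d).val = x := by
          have := pow_eq_pow_mod 1 hxd
          rw [pow_one] at this
          rw [ZMod.val_one_eq_one_mod, ← this]
        simpa [h1] using pow_mul_spectralProj (ψ := ψ) hxd 1 j
      simp only [antisymmPinching, LinearMap.coe_mk, AddHom.coe_mk, Matrix.mul_smul,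
        Matrix.smul_mul, Finset.mul_sum, Finset.sum_mul]
      congr 1
      refine Finset.sum_congr rfl fun j _ => ?_
      rw [← mul_assoc, ← mul_assoc, hc, mul_assoc _ _ x,
        (commute_spectralProj (Commute.refl x) j).eq, hc]
      simp [mul_assoc]
  map_id Y hY := by
    obtain ⟨h1, h2⟩ := hY
    simp only [antisymmPinching, LinearMap.coe_mk, AddHom.coe_mk, h1, sub_neg_eq_add, ← two_smul ℂ Y,
      Matrix.mul_smul, Matrix.smul_mul, ← Finset.smul_sum]
    rw [smul_smul, inv_mul_cancel₀ two_ne_zero, one_smul]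
    have h (j : ZMod d) : spectralProj ψ x j * Y * spectralProj ψ x j = spectralProj ψ x j * Y := by
      rw [mul_assoc, ← (commute_spectralProj h2 j).eq, ← mul_assoc,
        spectralProj_mul_spectralProj hψ hxd, if_pos rfl]
    simp_rw [h]
    rw [← Finset.sum_mul, sum_spectralProj hψ, one_mul]

theorem two_mul_finrank_soCentralizer_eq_trace (hd : Odd d) (hψ : ψ.IsPrimitive) (hx : xᵀ * x = 1)
    (hxd : x ^ d = 1) :
    (2 * Module.finrank ℂ (soCentralizer x) : ℂ) =
      ∑ j, (spectralProj ψ x j).trace ^ 2 - (spectralProj ψ x 0).trace := by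
  rw [← (isProj_antisymmPinching hψ hx hxd).trace, trace_antisymmPinching, ← mul_assoc,
    mul_inv_cancel₀ two_ne_zero, one_mul, Finset.sum_sub_distrib]
  congr 1
  have h (j : ZMod d) : (spectralProj ψ x j * (spectralProj ψ x j)ᵀ).trace =
      if j = 0 then (spectralProj ψ x 0).trace else 0 := by
    rw [transpose_spectralProj hx hxd, spectralProj_mul_spectralProj hψ hxd]
    simp only [ZMod.eq_neg_self_iff_of_odd hd]
    split_ifs with h <;> simp [h]
  simp [h]

end SpectralProjection

theorem even_apply_zero_of_even_sum {d : ℕ} [NeZero d] (hd : Odd d) {a : ZMod d → ℕ}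
    (ha : ∀ j, a (-j) = a j) (hsum : Even (∑ j, a j)) : Even (a 0) := by
  have h0 : ∑ j ∈ Finset.univ.erase (0 : ZMod d), (a j : ZMod 2) = 0 := by
    refine Finset.sum_involution (fun j _ => -j) (fun j _ => ?_) (fun j hj _ h => ?_)
      (fun j hj => ?_) (fun j _ => neg_neg j)
    · rw [ha]
      exact CharTwo.add_self_eq_zero _
    · exact (Finset.mem_erase.mp hj).1 ((ZMod.eq_neg_self_iff_of_odd hd j).mp h.symm)
    · simpa using hj
  rw [← Finset.add_sum_erase _ _ (Finset.mem_univ (0 : ZMod d)), ← ZMod.natCast_eq_zero_iff_even]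
    at hsum
  push_cast at hsum
  rwa [h0, add_zero, ZMod.natCast_eq_zero_iff_even] at hsum

theorem le_sum_sq_of_sum_eq {d m : ℕ} [NeZero d] (hd : Odd d) {a : ZMod d → ℕ}
    (ha : ∀ j, a (-j) = a j) (hsum : ∑ j, a j = 2 * (d * m) + 2) :
    4 * d * m ^ 2 + 6 * m + 2 + a 0 ≤ ∑ j, a j ^ 2 := by
  obtain ⟨b, hb⟩ := even_apply_zero_of_even_sum hd ha (hsum ▸ ⟨d * m + 1, by ring⟩)
  set α : ZMod d → ℤ := fun j => a j - 2 * m with hα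
  have hαsum : ∑ j, α j = 2 := by
    simp only [hα, Finset.sum_sub_distrib, Finset.sum_const, Finset.card_univ, ZMod.card]
    have : (∑ j, (a j : ℤ)) = 2 * (d * m) + 2 := by exact_mod_cast hsum
    rw [this, nsmul_eq_mul]
    ring
  have hsq : (∑ j, (a j : ℤ) ^ 2) = 4 * d * m ^ 2 + 8 * m + ∑ j, α j ^ 2 := by
    have h (j : ZMod d) : (a j : ℤ) ^ 2 = 4 * m ^ 2 + 4 * m * α j + α j ^ 2 := by
      simp only [hα]
      ring
    simp only [h, Finset.sum_add_distrib, ← Finset.mul_sum, hαsum, Finset.sum_const,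
      Finset.card_univ, ZMod.card, nsmul_eq_mul]
    ring
  have hkey : 2 + α 0 ≤ ∑ j, α j ^ 2 := by
    by_cases h0 : α 0 = 0
    · have : ∑ j, α j ≤ ∑ j, α j ^ 2 := Finset.sum_le_sum fun j _ => Int.le_self_sq _
      omega
    · have h1 : α 0 ^ 2 ≤ ∑ j, α j ^ 2 :=
        Finset.single_le_sum (f := fun j => α j ^ 2) (fun j _ => sq_nonneg _) (Finset.mem_univ 0)
      obtain ⟨c, hc⟩ : ∃ c : ℤ, α 0 = 2 * c := ⟨b - m, by simp only [hα, hb]; push_cast; ring⟩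
      have hc0 : c ≠ 0 := by rintro rfl; simp [hc] at h0
      rw [hc] at h1 ⊢
      rcases lt_or_gt_of_ne hc0 with h | h <;> nlinarith
  zify
  rw [hsq]
  have : α 0 = a 0 - 2 * m := rfl
  linarith

section SpectralMultiplicity

variable {N : Type*} [Fintype N] [DecidableEq N] {d : ℕ} [NeZero d]
variable {ψ : AddChar (ZMod d) ℂ} {x : Matrix N N ℂ}

theorem le_finrank_soCentralizer {m : ℕ} (hd : Odd d) (hψ : ψ.IsPrimitive) (hx : xᵀ * x = 1)
    (hxd : x ^ d = 1) (hN : Fintype.card N = 2 * (d * m) + 2) :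
    2 * d * m ^ 2 + 3 * m + 1 ≤ Module.finrank ℂ (soCentralizer x) := by
  have h (j : ZMod d) : ∃ a : ℕ, (spectralProj ψ x j).trace = a :=
    Matrix.exists_trace_eq_natCast_of_isIdempotentElem
      (by rw [spectralProj_mul_spectralProj hψ hxd, if_pos rfl])
  choose a ha using h
  have hneg (j : ZMod d) : a (-j) = a j := by
    have := ha (-j)
    rw [← transpose_spectralProj hx hxd, Matrix.trace_transpose, ha] at this
    exact_mod_cast this.symm
  have hsum : ∑ j, a j = 2 * (d * m) + 2 := by
    have h1 : (∑ j, spectralProj ψ x j).trace = Fintype.card N := by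
      rw [sum_spectralProj hψ, Matrix.trace_one]
    rw [Matrix.trace_sum] at h1
    simp only [ha, hN] at h1
    exact_mod_cast h1
  have hdim := two_mul_finrank_soCentralizer_eq_trace hd hψ hx hxd
  simp only [ha] at hdim
  have hdim' : 2 * Module.finrank ℂ (soCentralizer x) + a 0 = ∑ j, a j ^ 2 := by
    rw [eq_sub_iff_add_eq] at hdim
    exact_mod_cast hdim
  have := le_sum_sq_of_sum_eq hd hneg hsum
  nlinarith

theorem finrank_soCentralizer_of_trace {m : ℕ} (hd : Odd d) (hψ : ψ.IsPrimitive)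
    (hx : xᵀ * x = 1) (hxd : x ^ d = 1) (e : ZMod d)
    (htr : ∀ j, (spectralProj ψ x j).trace =
      2 * m + (if j = e then 1 else 0) + (if j = -e then 1 else 0)) :
    Module.finrank ℂ (soCentralizer x) = 2 * d * m ^ 2 + 3 * m + 1 := by
  have hdim := two_mul_finrank_soCentralizer_eq_trace hd hψ hx hxd
  have hsq (j : ZMod d) : (spectralProj ψ x j).trace ^ 2 = 4 * m ^ 2 +
      (if j = e then (4 * m + 1 : ℂ) else 0) + (if j = -e then (4 * m + 1 : ℂ) else 0) +
      (if j = e then (if e = 0 then 2 else 0) else 0) := by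
    have he := ZMod.eq_neg_self_iff_of_odd hd e
    rw [htr]
    split_ifs <;> first | ring1 | (exfalso; simp_all)
  simp only [hsq, htr 0, Finset.sum_add_distrib, Finset.sum_ite_eq', Finset.mem_univ, if_true,
    Finset.sum_const, Finset.card_univ, ZMod.card, nsmul_eq_mul, eq_comm (a := (0 : ZMod d)),
    neg_eq_zero] at hdim
  have h2 : (2 * Module.finrank ℂ (soCentralizer x) : ℂ) =
      2 * (2 * d * m ^ 2 + 3 * m + 1 : ℕ) := by
    rw [hdim]
    push_cast
    split_ifs <;> ring
  exact_mod_cast mul_left_cancel₀ two_ne_zero h2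

end SpectralMultiplicity

/-- The projection of `ℂ²` onto an isotropic line along the other one. -/
noncomputable def isotropicProj : Matrix (Fin 2) (Fin 2) ℂ :=
  !![2⁻¹, 2⁻¹ * Complex.I; -(2⁻¹ * Complex.I), 2⁻¹]

theorem isotropicProj_mul_self : isotropicProj * isotropicProj = isotropicProj := by
  ext i j
  fin_cases i <;> fin_cases j <;> simp [isotropicProj, Matrix.mul_apply] <;> ring_nf <;>
    simp [Complex.I_sq] <;> ring_nf

theorem isotropicProj_add_transpose : isotropicProj + isotropicProjᵀ = 1 := by
  ext i j
  fin_cases i <;> fin_cases j <;> simp [isotropicProj] <;> norm_num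

theorem isotropicProj_mul_transpose : isotropicProj * isotropicProjᵀ = 0 := by
  rw [eq_sub_of_add_eq' isotropicProj_add_transpose, mul_sub, isotropicProj_mul_self, mul_one,
    sub_self]

theorem transpose_mul_isotropicProj : isotropicProjᵀ * isotropicProj = 0 := by
  rw [eq_sub_of_add_eq' isotropicProj_add_transpose, sub_mul, isotropicProj_mul_self, one_mul,
    sub_self]

theorem transpose_isotropicProj_mul_self :
    isotropicProjᵀ * isotropicProjᵀ = isotropicProjᵀ := by
  rw [← Matrix.transpose_mul, isotropicProj_mul_self]

/-- The complex rotation with eigenvalues `a` and `b`. -/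
noncomputable def complexRotation (a b : ℂ) : Matrix (Fin 2) (Fin 2) ℂ :=
  a • isotropicProj + b • isotropicProjᵀ

theorem complexRotation_mul (a b a' b' : ℂ) :
    complexRotation a b * complexRotation a' b' = complexRotation (a * a') (b * b') := by
  simp only [complexRotation, add_mul, mul_add, Matrix.smul_mul, Matrix.mul_smul,
    isotropicProj_mul_self, isotropicProj_mul_transpose, transpose_mul_isotropicProj,
    transpose_isotropicProj_mul_self, smul_zero, add_zero, zero_add, smul_smul]
  rw [mul_comm a, mul_comm b]

theorem complexRotation_one : complexRotation 1 1 = 1 := by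
  simp [complexRotation, isotropicProj_add_transpose]

theorem complexRotation_pow (a b : ℂ) (k : ℕ) :
    complexRotation a b ^ k = complexRotation (a ^ k) (b ^ k) := by
  induction k with
  | zero => simp [complexRotation_one]
  | succ k ih => rw [pow_succ, ih, complexRotation_mul, pow_succ, pow_succ]

theorem transpose_complexRotation (a b : ℂ) :
    (complexRotation a b)ᵀ = complexRotation b a := by
  simp [complexRotation, add_comm]

theorem trace_complexRotation (a b : ℂ) : (complexRotation a b).trace = a + b := by
  simp [complexRotation, isotropicProj, Matrix.trace_fin_two]
  ring

theorem det_complexRotation (a b : ℂ) : (complexRotation a b).det = a * b := by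
  simp [complexRotation, isotropicProj, Matrix.det_fin_two]
  ring_nf
  simp [Complex.I_sq]
  ring

theorem charpoly_complexRotation (a b : ℂ) :
    (complexRotation a b).charpoly = (X - C a) * (X - C b) := by
  rw [Matrix.charpoly_fin_two, trace_complexRotation, det_complexRotation, C_add, C_mul]
  ring

theorem Matrix.charpoly_blockDiagonal {n o R : Type*} [Fintype n] [DecidableEq n] [Fintype o]
    [DecidableEq o] [CommRing R] (M : o → Matrix n n R) :
    (Matrix.blockDiagonal M).charpoly = ∏ k, (M k).charpoly := by
  simp only [Matrix.charpoly]
  rw [← Matrix.det_blockDiagonal]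
  congr 1
  ext ⟨i, k⟩ ⟨j, l⟩ : 1
  by_cases hkl : k = l
  · subst hkl
    by_cases hij : i = j
    · subst hij
      simp [Matrix.blockDiagonal_apply]
    · simp [Matrix.charmatrix_apply_ne, Matrix.blockDiagonal_apply, hij]
  · simp [Matrix.charmatrix_apply_ne, Matrix.blockDiagonal_apply, hkl]

section Construction

variable {d : ℕ} {ψ : AddChar (ZMod d) ℂ}

theorem AddChar.apply_pow_val [NeZero d] (c k : ZMod d) : ψ c ^ k.val = ψ (c * k) := by
  rw [← AddChar.map_nsmul_eq_pow, nsmul_eq_mul, ZMod.natCast_zmod_val, mul_comm]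

theorem AddChar.apply_pow_card (c : ZMod d) : ψ c ^ d = 1 := by
  rw [← AddChar.map_nsmul_eq_pow, nsmul_eq_mul, ZMod.natCast_self, zero_mul,
    AddChar.map_zero_eq_one]

theorem X_pow_sub_one_eq_prod_addChar [NeZero d] (hψ : IsPrimitiveRoot (ψ 1) d) :
    (X : ℂ[X]) ^ d - 1 = ∏ j : ZMod d, (X - C (ψ j)) := by
  have h := X_pow_sub_C_eq_prod hψ (NeZero.pos d) (one_pow d)
  rw [C_1] at h
  rw [h]
  refine (Finset.prod_nbij' (fun j : ZMod d => j.val) (fun i : ℕ => (i : ZMod d))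
    (fun j _ => Finset.mem_range.mpr j.val_lt) (fun _ _ => Finset.mem_univ _)
    (fun j _ => ZMod.natCast_zmod_val j)
    (fun i hi => ZMod.val_cast_of_lt (Finset.mem_range.mp hi)) (fun j _ => ?_)).symm
  rw [mul_one, AddChar.apply_pow_val, one_mul]

theorem inv_mul_sum_addChar [NeZero d] (hψ : ψ.IsPrimitive) (j c : ZMod d) :
    (d : ℂ)⁻¹ * ∑ k, ψ (-(j * k)) * ψ (c * k) = if j = c then 1 else 0 := by
  have hd : (d : ℂ) ≠ 0 := NeZero.ne _
  have h (k : ZMod d) : ψ (-(j * k)) * ψ (c * k) = ψ (k * (c - j)) := by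
    rw [← AddChar.map_add_eq_mul]
    congr 1
    ring
  simp_rw [h]
  rw [AddChar.sum_mulShift _ hψ, ZMod.card]
  by_cases hjc : j = c
  · simp [hjc, hd]
  · simp [hjc, sub_eq_zero, Ne.symm hjc]

/-- The orthogonal matrix which is an orthogonal sum of planes on which it acts with
eigenvalues `ψ (c k)` and `ψ (-c k)`. -/
noncomputable def rotationSum {N K : Type*} [DecidableEq K]
    (f : Fin 2 × K ≃ N) (ψ : AddChar (ZMod d) ℂ) (c : K → ZMod d) : Matrix N N ℂ :=
  Matrix.reindex f f (Matrix.blockDiagonal fun k => complexRotation (ψ (c k)) (ψ (-c k)))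

variable {N K : Type*} [DecidableEq N] [DecidableEq K] [Fintype N] [Fintype K]
  (f : Fin 2 × K ≃ N) (c : K → ZMod d)

theorem rotationSum_pow (r : ℕ) : rotationSum f ψ c ^ r = Matrix.reindex f f
    (Matrix.blockDiagonal fun k => complexRotation (ψ (c k) ^ r) (ψ (-c k) ^ r)) := by
  rw [rotationSum, ← Matrix.coe_reindexAlgEquiv ℂ ℂ, ← map_pow, ← Matrix.blockDiagonal_pow,
    Matrix.coe_reindexAlgEquiv]
  congr 3
  ext1 k
  rw [Pi.pow_apply, complexRotation_pow]

theorem rotationSum_pow_card : rotationSum f ψ c ^ d = 1 := by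
  rw [rotationSum_pow]
  simp only [AddChar.apply_pow_card, complexRotation_one]
  rw [← Pi.one_def, Matrix.blockDiagonal_one]
  simp

theorem transpose_rotationSum_mul_self : (rotationSum f ψ c)ᵀ * rotationSum f ψ c = 1 := by
  rw [rotationSum, Matrix.transpose_reindex, Matrix.blockDiagonal_transpose]
  rw [Matrix.reindex_apply, Matrix.reindex_apply, Matrix.submatrix_mul_equiv,
    ← Matrix.blockDiagonal_mul]
  simp only [transpose_complexRotation, complexRotation_mul, ← AddChar.map_add_eq_mul,
    neg_add_cancel, add_neg_cancel, AddChar.map_zero_eq_one, complexRotation_one]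
  rw [← Pi.one_def, Matrix.blockDiagonal_one]
  simp

theorem det_rotationSum : (rotationSum f ψ c).det = 1 := by
  rw [rotationSum, Matrix.det_reindex_self, Matrix.det_blockDiagonal]
  simp [det_complexRotation, ← AddChar.map_add_eq_mul]

theorem charpoly_rotationSum :
    (rotationSum f ψ c).charpoly = ∏ k, ((X - C (ψ (c k))) * (X - C (ψ (-c k)))) := by
  rw [rotationSum, Matrix.charpoly_reindex, Matrix.charpoly_blockDiagonal]
  simp only [charpoly_complexRotation]

theorem trace_spectralProj_rotationSum [NeZero d] (hψ : ψ.IsPrimitive) (j : ZMod d) :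
    (spectralProj ψ (rotationSum f ψ c) j).trace =
      ∑ k, ((if j = c k then 1 else 0) + (if j = -c k then 1 else 0)) := by
  have htr (r : ZMod d) : (rotationSum f ψ c ^ r.val).trace =
      ∑ k, (ψ (c k * r) + ψ (-c k * r)) := by
    have hreindex (M : Matrix (Fin 2 × K) (Fin 2 × K) ℂ) :
        (Matrix.reindex f f M).trace = M.trace := Equiv.sum_comp f.symm M.diag
    rw [rotationSum_pow, hreindex, Matrix.trace_blockDiagonal]
    simp only [trace_complexRotation, AddChar.apply_pow_val]
  simp only [spectralProj, Matrix.trace_smul, Matrix.trace_sum, htr, smul_eq_mul, Finset.mul_sum]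
  rw [Finset.sum_comm]
  refine Finset.sum_congr rfl fun k _ => ?_
  rw [← inv_mul_sum_addChar hψ, ← inv_mul_sum_addChar hψ, ← mul_add, ← Finset.sum_add_distrib,
    Finset.mul_sum]
  simp only [mul_add]

theorem exists_orthogonal_matrix_charpoly [NeZero d] {n m : ℕ} (hd : Odd d) (hm : n = d * m)
    (hψ : ψ.IsPrimitive) (hψ1 : IsPrimitiveRoot (ψ 1) d) (e : ZMod d) :
    ∃ x : Matrix (Fin (2 * n + 2)) (Fin (2 * n + 2)) ℂ, xᵀ * x = 1 ∧ x.det = 1 ∧ x ^ d = 1 ∧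
      x.charpoly = ((X : ℂ[X]) ^ d - 1) ^ (2 * m) * ((X - C (ψ e)) * (X - C (ψ (-e)))) ∧
      Module.finrank ℂ (soCentralizer x) = 2 * d * m ^ 2 + 3 * m + 1 := by
  obtain ⟨c, hnone, hsome⟩ : ∃ c : Option (ZMod d × Fin m) → ZMod d,
      c none = e ∧ ∀ p, c (some p) = p.1 := ⟨fun o => o.elim e Prod.fst, rfl, fun _ => rfl⟩
  have hcard : Fintype.card (Fin 2 × Option (ZMod d × Fin m)) = 2 * n + 2 := by
    simp [ZMod.card, hm]
    ring
  let f := Fintype.equivFinOfCardEq hcard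
  refine ⟨rotationSum f ψ c, transpose_rotationSum_mul_self f c, det_rotationSum f c,
    rotationSum_pow_card f c, ?_, ?_⟩
  · rw [charpoly_rotationSum, Fintype.prod_option, Fintype.prod_prod_type, mul_comm]
    simp only [hnone, hsome, Finset.prod_const, Finset.card_univ,
      Fintype.card_fin, Finset.prod_pow, Finset.prod_mul_distrib]
    congr 1
    have hneg : ∏ j, (X - C (ψ (-j))) = ∏ j, (X - C (ψ j)) :=
      Equiv.prod_comp (Equiv.neg (ZMod d)) (fun j => X - C (ψ j))
    rw [hneg, ← X_pow_sub_one_eq_prod_addChar hψ1, ← sq, ← pow_mul]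
  · refine finrank_soCentralizer_of_trace hd hψ (transpose_rotationSum_mul_self f c)
      (rotationSum_pow_card f c) e fun j => ?_
    rw [trace_spectralProj_rotationSum f c hψ, Fintype.sum_option, Fintype.sum_prod_type]
    simp [hnone, hsome, Finset.sum_add_distrib, ← neg_eq_iff_eq_neg (a := j)]
    ring

end Construction

/-- for `d ≥ 3` odd dividing `n` with `m = n/d`, and `ζ` a primitive `d`-th
root of unity, there are two elements `x₁, x₂` of `SO_{2n+2}(ℂ)` of order dividing `d`
with characteristic polynomials `(T^d − 1)^{2m}(T − 1)²` and
`(T^d − 1)^{2m}(T − ζ)(T − ζ⁻¹)` respectively, whose centralizers in `𝔰𝔬_{2n+2}(ℂ)` both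
have dimension `2dm² + 3m + 1`; this is the minimal centralizer dimension among all
`x ∈ SO_{2n+2}(ℂ)` with `x^d = 1`, and `x₁`, `x₂` are not conjugate in `SO_{2n+2}(ℂ)`
(they have different characteristic polynomials). -/
theorem so_even_two_minimal_classes (n d m : ℕ) (hd3 : 3 ≤ d) (hdodd : Odd d)
    (hm : n = d * m) (ζ : ℂ) (hζ : IsPrimitiveRoot ζ d) :
    ∃ x₁ x₂ : Matrix (Fin (2 * n + 2)) (Fin (2 * n + 2)) ℂ,
      x₁ᵀ * x₁ = 1 ∧ x₁.det = 1 ∧ x₂ᵀ * x₂ = 1 ∧ x₂.det = 1 ∧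
      x₁ ^ d = 1 ∧ x₂ ^ d = 1 ∧
      x₁.charpoly = ((X : ℂ[X]) ^ d - 1) ^ (2 * m) * (X - 1) ^ 2 ∧
      x₂.charpoly = ((X : ℂ[X]) ^ d - 1) ^ (2 * m) * ((X - C ζ) * (X - C ζ⁻¹)) ∧
      Module.finrank ℂ (soCentralizer x₁) = 2 * d * m ^ 2 + 3 * m + 1 ∧
      Module.finrank ℂ (soCentralizer x₂) = 2 * d * m ^ 2 + 3 * m + 1 ∧
      IsLeast {s : ℕ | ∃ x : Matrix (Fin (2 * n + 2)) (Fin (2 * n + 2)) ℂ,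
          xᵀ * x = 1 ∧ x.det = 1 ∧ x ^ d = 1 ∧ s = Module.finrank ℂ (soCentralizer x)}
        (2 * d * m ^ 2 + 3 * m + 1) ∧
      x₁.charpoly ≠ x₂.charpoly ∧
      ¬ ∃ g : Matrix (Fin (2 * n + 2)) (Fin (2 * n + 2)) ℂ,
          gᵀ * g = 1 ∧ g.det = 1 ∧ g * x₁ = x₂ * g := by
  have : NeZero d := ⟨by omega⟩
  set ψ := AddChar.zmodChar d hζ.pow_eq_one
  have hψ : ψ.IsPrimitive := AddChar.zmodChar_primitive_of_primitive_root d hζ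
  have hψ1 : ψ 1 = ζ := by
    simpa using AddChar.zmodChar_apply' hζ.pow_eq_one 1
  obtain ⟨x₁, ho₁, hdet₁, hd₁, hc₁, hf₁⟩ :=
    exists_orthogonal_matrix_charpoly hdodd hm hψ (hψ1.symm ▸ hζ) 0
  obtain ⟨x₂, ho₂, hdet₂, hd₂, hc₂, hf₂⟩ :=
    exists_orthogonal_matrix_charpoly hdodd hm hψ (hψ1.symm ▸ hζ) 1
  rw [neg_zero, AddChar.map_zero_eq_one, C_1, ← sq] at hc₁
  rw [AddChar.map_neg_eq_inv, hψ1] at hc₂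
  have hne : x₁.charpoly ≠ x₂.charpoly := by
    rw [hc₁, hc₂]
    intro h
    have h1 := congrArg (eval 1) (mul_left_cancel₀
      (pow_ne_zero _ (X_pow_sub_C_ne_zero (NeZero.pos d) (1 : ℂ))) h)
    have hζ1 : ζ ≠ 1 := hζ.ne_one (by omega)
    simp only [eval_pow, eval_sub, eval_X, eval_one, eval_mul, eval_C, sub_self, ne_eq,
      OfNat.ofNat_ne_zero, not_false_eq_true, zero_pow, zero_eq_mul, sub_eq_zero] at h1
    rcases h1 with h1 | h1
    · exact hζ1 h1.symm
    · exact hζ1 (inv_eq_one.mp h1.symm)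
  refine ⟨x₁, x₂, ho₁, hdet₁, ho₂, hdet₂, hd₁, hd₂, hc₁, hc₂, hf₁, hf₂,
    ⟨⟨x₁, ho₁, hdet₁, hd₁, hf₁.symm⟩, ?_⟩, hne, ?_⟩
  · rintro s ⟨x, hx, -, hxd, rfl⟩
    exact le_finrank_soCentralizer hdodd hψ hx hxd (by rw [Fintype.card_fin, hm])
  · rintro ⟨g, hg, -, hgx⟩
    have hg' : g * gᵀ = 1 := mul_eq_one_comm.mp hg
    refine hne ?_
    have h := Matrix.charpoly_units_conj ⟨g, gᵀ, hg', hg⟩ x₁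
    rw [← h, Matrix.inv_eq_right_inv hg', hgx, mul_assoc, hg', mul_one]
end

section
/- (Type C_n case of the theorem on the adjoint representation restricted to the principal SL₂.) Let n ≥ 1 and let z be a nonzero complex number with z⁴ ≠ 1. Let J be the standard 2n×2n symplectic matrix and let t = diag(D, D^{−1}) ∈ Sp(2n, ℂ), where D = diag(z^{2n−1}, z^{2n−3}, …, z). Then the trace of the linear map Y ↦ t Y t^{−1} on the subspace 𝔰𝔭_{2n}(ℂ) = {Y ∈ M_{2n}(ℂ) : Yᵀ J + J Y = 0} equals z^{−(4n−2)}·(1 − z^{4n})(1 − z^{4n+2})/((1 − z²)(1 − z⁴)). -/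
open scoped Matrix

/-- The symplectic Lie algebra `𝔰𝔭_{2n}(ℂ) = {Y : Yᵀ J + J Y = 0}`. -/
noncomputable def spSubmodule (n : ℕ) :
    Submodule ℂ (Matrix (Fin n ⊕ Fin n) (Fin n ⊕ Fin n) ℂ) where
  carrier := {Y | Yᵀ * stdSymplectic n + stdSymplectic n * Y = 0}
  zero_mem' := by simp
  add_mem' := by
    intro Y Z hY hZ
    have h1 : Yᵀ * stdSymplectic n + stdSymplectic n * Y = 0 := hY
    have g1 : Zᵀ * stdSymplectic n + stdSymplectic n * Z = 0 := hZ
    show (Y + Z)ᵀ * stdSymplectic n + stdSymplectic n * (Y + Z) = 0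
    calc (Y + Z)ᵀ * stdSymplectic n + stdSymplectic n * (Y + Z)
        = (Yᵀ * stdSymplectic n + stdSymplectic n * Y) +
            (Zᵀ * stdSymplectic n + stdSymplectic n * Z) := by
          rw [Matrix.transpose_add, Matrix.add_mul, Matrix.mul_add]; abel
      _ = 0 := by rw [h1, g1, add_zero]
  smul_mem' := by
    intro c Y hY
    have h1 : Yᵀ * stdSymplectic n + stdSymplectic n * Y = 0 := hY
    show (c • Y)ᵀ * stdSymplectic n + stdSymplectic n * (c • Y) = 0
    rw [Matrix.transpose_smul, Matrix.smul_mul, Matrix.mul_smul, ← smul_add, h1, smul_zero]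

/-- The diagonal matrix `D = diag(z^{2n−1}, z^{2n−3}, …, z)`. -/
noncomputable def principalDiagC (n : ℕ) (z : ℂ) : Matrix (Fin n) (Fin n) ℂ :=
  Matrix.diagonal fun i => z ^ (2 * (n : ℤ) - 2 * ((i : ℕ) : ℤ) - 1)

theorem LinearMap.trace_matrix_eq_sum {R m : Type*} [CommRing R] [Fintype m] [DecidableEq m]
    (F : Matrix m m R →ₗ[R] Matrix m m R) :
    LinearMap.trace R (Matrix m m R) F = ∑ a, ∑ b, F (Matrix.single a b 1) a b := by
  rw [LinearMap.trace_eq_matrix_trace R (Matrix.stdBasis R m m), Matrix.trace,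
    Fintype.sum_prod_type]
  refine Finset.sum_congr rfl fun a _ => Finset.sum_congr rfl fun b _ => ?_
  rw [Matrix.diag_apply, LinearMap.toMatrix_apply, Matrix.stdBasis_eq_single]
  rfl

theorem stdSymplectic_transpose (n : ℕ) : (stdSymplectic n)ᵀ = -stdSymplectic n := by
  simp [stdSymplectic, Matrix.fromBlocks_transpose, Matrix.fromBlocks_neg]

theorem stdSymplectic_mul_self (n : ℕ) : stdSymplectic n * stdSymplectic n = -1 := by
  rw [stdSymplectic, Matrix.fromBlocks_multiply, ← Matrix.fromBlocks_one, Matrix.fromBlocks_neg]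
  simp

theorem stdSymplectic_mul_mul_self (n : ℕ) (Y : Matrix (Fin n ⊕ Fin n) (Fin n ⊕ Fin n) ℂ) :
    stdSymplectic n * (stdSymplectic n * Y) = -Y := by
  rw [← Matrix.mul_assoc, stdSymplectic_mul_self, Matrix.neg_mul, Matrix.one_mul]

theorem mem_spSubmodule_iff {n : ℕ} {Y : Matrix (Fin n ⊕ Fin n) (Fin n ⊕ Fin n) ℂ} :
    Y ∈ spSubmodule n ↔ stdSymplectic n * Yᵀ * stdSymplectic n = Y := by
  change Yᵀ * stdSymplectic n + stdSymplectic n * Y = 0 ↔ _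
  constructor
  · intro h
    rw [Matrix.mul_assoc, eq_neg_of_add_eq_zero_left h, Matrix.mul_neg,
      stdSymplectic_mul_mul_self, neg_neg]
  · intro h
    nth_rewrite 2 [← h]
    rw [Matrix.mul_assoc, stdSymplectic_mul_mul_self, add_neg_cancel]

/-- The diagonal entries of `diag(D, D⁻¹)`. -/
noncomputable def principalWeight (n : ℕ) (z : ℂ) : Fin n ⊕ Fin n → ℂ :=
  Sum.elim (fun i => z ^ (2 * (n : ℤ) - 2 * ((i : ℕ) : ℤ) - 1))
    (fun i => (z ^ (2 * (n : ℤ) - 2 * ((i : ℕ) : ℤ) - 1))⁻¹)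

theorem principalWeight_ne_zero (n : ℕ) {z : ℂ} (hz : z ≠ 0) (a : Fin n ⊕ Fin n) :
    principalWeight n z a ≠ 0 := by
  rcases a with i | i
  · exact zpow_ne_zero _ hz
  · exact inv_ne_zero (zpow_ne_zero _ hz)

theorem Matrix.inv_diagonal_of_ne_zero {K m : Type*} [Field K] [Fintype m] [DecidableEq m]
    {d : m → K} (hd : ∀ a, d a ≠ 0) :
    (Matrix.diagonal d)⁻¹ = Matrix.diagonal fun a => (d a)⁻¹ := by
  apply Matrix.inv_eq_right_inv
  rw [Matrix.diagonal_mul_diagonal, ← Matrix.diagonal_one]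
  congr 1
  funext a
  exact mul_inv_cancel₀ (hd a)

theorem fromBlocks_principalDiagC (n : ℕ) {z : ℂ} (hz : z ≠ 0) :
    Matrix.fromBlocks (principalDiagC n z) 0 0 (principalDiagC n z)⁻¹ =
      Matrix.diagonal (principalWeight n z) := by
  rw [principalDiagC, Matrix.inv_diagonal_of_ne_zero fun _ => zpow_ne_zero _ hz,
    Matrix.fromBlocks_diagonal]
  rfl

theorem stdSymplectic_mul_diagonal (n : ℕ) (z : ℂ) :
    stdSymplectic n * Matrix.diagonal (principalWeight n z) =
      Matrix.diagonal (fun a => (principalWeight n z a)⁻¹) * stdSymplectic n := by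
  ext a b
  rw [Matrix.mul_diagonal, Matrix.diagonal_mul]
  rcases a with i | i <;> rcases b with j | j <;> by_cases h : i = j <;>
    simp [stdSymplectic, principalWeight, h]

theorem diagonal_mul_stdSymplectic (n : ℕ) (z : ℂ) :
    Matrix.diagonal (principalWeight n z) * stdSymplectic n =
      stdSymplectic n * Matrix.diagonal (fun a => (principalWeight n z a)⁻¹) := by
  ext a b
  rw [Matrix.mul_diagonal, Matrix.diagonal_mul]
  rcases a with i | i <;> rcases b with j | j <;> by_cases h : i = j <;>
    simp [stdSymplectic, principalWeight, h]

theorem diagonal_conj_mem_spSubmodule {n : ℕ} {z : ℂ}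
    {Y : Matrix (Fin n ⊕ Fin n) (Fin n ⊕ Fin n) ℂ} (hY : Y ∈ spSubmodule n) :
    Matrix.diagonal (principalWeight n z) * Y *
      Matrix.diagonal (fun a => (principalWeight n z a)⁻¹) ∈ spSubmodule n := by
  rw [mem_spSubmodule_iff] at hY ⊢
  nth_rewrite 2 [← hY]
  simp only [Matrix.transpose_mul, Matrix.diagonal_transpose, Matrix.mul_assoc]
  rw [diagonal_mul_stdSymplectic, ← Matrix.mul_assoc (stdSymplectic n) (Matrix.diagonal _),
    ← Matrix.mul_assoc (Matrix.diagonal _) (stdSymplectic n), diagonal_mul_stdSymplectic]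

/-- The projection `Y ↦ (Y + J Yᵀ J) / 2` of the matrix algebra onto `𝔰𝔭_{2n}(ℂ)`. -/
noncomputable def spProjection (n : ℕ) :
    Matrix (Fin n ⊕ Fin n) (Fin n ⊕ Fin n) ℂ →ₗ[ℂ]
      Matrix (Fin n ⊕ Fin n) (Fin n ⊕ Fin n) ℂ where
  toFun Y := (2⁻¹ : ℂ) • (Y + stdSymplectic n * Yᵀ * stdSymplectic n)
  map_add' Y Z := by
    rw [← smul_add, Matrix.transpose_add, Matrix.mul_add, Matrix.add_mul]
    congr 1
    abel
  map_smul' c Y := by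
    rw [Matrix.transpose_smul, Matrix.mul_smul, Matrix.smul_mul, ← smul_add, smul_comm,
      RingHom.id_apply]

theorem spProjection_apply (n : ℕ) (Y : Matrix (Fin n ⊕ Fin n) (Fin n ⊕ Fin n) ℂ) :
    spProjection n Y = (2⁻¹ : ℂ) • (Y + stdSymplectic n * Yᵀ * stdSymplectic n) := rfl

theorem spProjection_mem (n : ℕ) (Y : Matrix (Fin n ⊕ Fin n) (Fin n ⊕ Fin n) ℂ) :
    spProjection n Y ∈ spSubmodule n := by
  rw [spProjection_apply]
  apply Submodule.smul_mem
  rw [mem_spSubmodule_iff]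
  simp only [Matrix.transpose_add, Matrix.transpose_mul, Matrix.transpose_transpose,
    stdSymplectic_transpose, Matrix.mul_add, Matrix.add_mul, Matrix.mul_assoc, Matrix.mul_neg,
    Matrix.neg_mul, stdSymplectic_mul_mul_self, stdSymplectic_mul_self, Matrix.mul_one, neg_neg]
  abel

theorem spProjection_of_mem {n : ℕ} {Y : Matrix (Fin n ⊕ Fin n) (Fin n ⊕ Fin n) ℂ}
    (hY : Y ∈ spSubmodule n) : spProjection n Y = Y := by
  rw [spProjection_apply, mem_spSubmodule_iff.1 hY, ← two_smul ℂ Y, smul_smul]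
  norm_num

theorem spProjection_single_apply (n : ℕ) (a b : Fin n ⊕ Fin n) :
    spProjection n (Matrix.single a b 1) a b = 2⁻¹ * (1 + stdSymplectic n a b ^ 2) := by
  rw [spProjection_apply, Matrix.transpose_single]
  simp [Matrix.mul_apply, Matrix.single_apply, ite_and, pow_two]

theorem sum_principalWeight (n : ℕ) (z : ℂ) :
    ∑ a, principalWeight n z a =
      ∑ i : Fin n, (z ^ (2 * (n : ℤ) - 2 * ((i : ℕ) : ℤ) - 1) +
        (z ^ (2 * (n : ℤ) - 2 * ((i : ℕ) : ℤ) - 1))⁻¹) := by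
  rw [Fintype.sum_sum_type, Finset.sum_add_distrib]
  rfl

theorem sum_principalWeight_inv (n : ℕ) (z : ℂ) :
    ∑ a, (principalWeight n z a)⁻¹ = ∑ a, principalWeight n z a := by
  rw [Fintype.sum_sum_type, Fintype.sum_sum_type, add_comm]
  simp [principalWeight]

theorem sum_principalWeight_mul (n : ℕ) {z : ℂ} (hz : z ≠ 0) :
    (∑ a, principalWeight n z a) * (z - z⁻¹) = z ^ (2 * (n : ℤ)) - (z ^ (2 * (n : ℤ)))⁻¹ := by
  rw [sum_principalWeight]
  induction n with
  | zero => simp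
  | succ n ih =>
    have key (i : ℕ) : 2 * ((n + 1 : ℕ) : ℤ) - 2 * ((i + 1 : ℕ) : ℤ) - 1 =
        2 * (n : ℤ) - 2 * (i : ℤ) - 1 := by push_cast; ring
    have h0 : 2 * ((n + 1 : ℕ) : ℤ) - 2 * ((0 : ℕ) : ℤ) - 1 = 2 * (n : ℤ) + 1 := by
      push_cast; ring
    have h1 : 2 * ((n + 1 : ℕ) : ℤ) = 2 * (n : ℤ) + 1 + 1 := by push_cast; ring
    rw [Fin.sum_univ_succ, add_mul]
    simp only [Fin.val_succ, key, Fin.val_zero, h0]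
    rw [ih, h1]
    simp only [zpow_add_one₀ hz]
    have hw := zpow_ne_zero (2 * (n : ℤ)) hz
    generalize z ^ (2 * (n : ℤ)) = w at hw ⊢
    field_simp
    ring

theorem sum_stdSymplectic_sq_mul (n : ℕ) (z : ℂ) :
    ∑ a, ∑ b, principalWeight n z a * (principalWeight n z b)⁻¹ * stdSymplectic n a b ^ 2 =
      ∑ a, principalWeight n (z ^ 2) a := by
  simp only [Fintype.sum_sum_type, principalWeight, stdSymplectic, Sum.elim_inl, Sum.elim_inr,
    Matrix.fromBlocks_apply₁₁, Matrix.fromBlocks_apply₁₂, Matrix.fromBlocks_apply₂₁,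
    Matrix.fromBlocks_apply₂₂, Matrix.zero_apply, Matrix.neg_apply, Matrix.one_apply, neg_sq,
    ite_pow, one_pow, inv_inv]
  have hsq (k : ℤ) : (z ^ 2) ^ k = z ^ k * z ^ k := by rw [pow_two, mul_zpow]
  simp [hsq]

/-- The conjugation `Y ↦ t Y t⁻¹` by `t = diag(D, D⁻¹)`. -/
noncomputable def principalConj (n : ℕ) (z : ℂ) :
    Matrix (Fin n ⊕ Fin n) (Fin n ⊕ Fin n) ℂ →ₗ[ℂ]
      Matrix (Fin n ⊕ Fin n) (Fin n ⊕ Fin n) ℂ :=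
  LinearMap.mulLeftRight ℂ (Matrix.diagonal (principalWeight n z),
    Matrix.diagonal fun a => (principalWeight n z a)⁻¹)

theorem principalConj_apply (n : ℕ) (z : ℂ) (Y : Matrix (Fin n ⊕ Fin n) (Fin n ⊕ Fin n) ℂ) :
    principalConj n z Y = Matrix.diagonal (principalWeight n z) * Y *
      Matrix.diagonal (fun a => (principalWeight n z a)⁻¹) :=
  LinearMap.mulLeftRight_apply ..

/-- The trace of conjugation composed with the projection onto `𝔰𝔭_{2n}(ℂ)` is the character
of the symmetric square of the standard representation. -/
theorem trace_principalConj_comp_spProjection (n : ℕ) (z : ℂ) :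
    LinearMap.trace ℂ _ (principalConj n z ∘ₗ spProjection n) =
      2⁻¹ * ((∑ a, principalWeight n z a) ^ 2 + ∑ a, principalWeight n (z ^ 2) a) := by
  rw [LinearMap.trace_matrix_eq_sum, ← sum_stdSymplectic_sq_mul, pow_two]
  nth_rewrite 2 [← sum_principalWeight_inv]
  rw [Finset.sum_mul_sum]
  simp only [← Finset.sum_add_distrib, Finset.mul_sum]
  refine Finset.sum_congr rfl fun a _ => Finset.sum_congr rfl fun b _ => ?_
  rw [LinearMap.comp_apply, principalConj_apply, Matrix.mul_diagonal, Matrix.diagonal_mul,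
    spProjection_single_apply]
  ring

theorem symmetricSquare_principalWeight (n : ℕ) {z : ℂ} (hz : z ≠ 0) (hz4 : z ^ 4 ≠ 1) :
    2⁻¹ * ((∑ a, principalWeight n z a) ^ 2 + ∑ a, principalWeight n (z ^ 2) a) =
      z ^ (-(4 * (n : ℤ) - 2)) *
        ((1 - z ^ (4 * (n : ℤ))) * (1 - z ^ (4 * (n : ℤ) + 2))) /
          ((1 - z ^ 2) * (1 - z ^ 4)) := by
  have h4 : 1 - z ^ 4 ≠ 0 := sub_ne_zero.2 hz4.symm
  have h2 : 1 - z ^ 2 ≠ 0 := fun h => h4 (by linear_combination (1 + z ^ 2) * h)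
  have hs := sum_principalWeight_mul n hz
  have ht := sum_principalWeight_mul n (pow_ne_zero 2 hz)
  set S := ∑ a, principalWeight n z a
  set T := ∑ a, principalWeight n (z ^ 2) a
  set w := z ^ (2 * (n : ℤ)) with hw
  have hw0 : w ≠ 0 := zpow_ne_zero _ hz
  have e1 : (z ^ 2) ^ (2 * (n : ℤ)) = w ^ 2 := by
    rw [hw, ← zpow_natCast, ← zpow_natCast, ← zpow_mul, ← zpow_mul, mul_comm]
  have e2 : z ^ (4 * (n : ℤ)) = w ^ 2 := by
    rw [hw, ← zpow_natCast, ← zpow_mul]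
    congr 1
    push_cast
    ring
  have e3 : z ^ (4 * (n : ℤ) + 2) = w ^ 2 * z ^ 2 := by
    rw [zpow_add₀ hz, e2]
    norm_cast
  have e4 : z ^ (-(4 * (n : ℤ) - 2)) = z ^ 2 / w ^ 2 := by
    rw [neg_sub, zpow_sub₀ hz, e2]
    norm_cast
  rw [e1] at ht
  rw [e2, e3, e4]
  have hS : S = z * (1 - w ^ 2) / (w * (1 - z ^ 2)) := by
    field_simp at hs ⊢
    linear_combination -hs
  have hT : T = z ^ 2 * (1 - w ^ 4) / (w ^ 2 * (1 - z ^ 4)) := by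
    field_simp at ht ⊢
    linear_combination -ht
  rw [hS, hT]
  field_simp
  ring

/-- type `C_n` case: for `n ≥ 1`, `z ≠ 0`, `z⁴ ≠ 1`, the trace of
`Y ↦ t Y t⁻¹` on `𝔰𝔭_{2n}(ℂ)`, where `t = diag(D, D⁻¹)` with
`D = diag(z^{2n−1}, …, z)` (the image of `diag(z, z⁻¹)` under the principal `SL₂` of
`Sp(2n, ℂ)`), equals `z^{−(4n−2)}(1 − z^{4n})(1 − z^{4n+2})/((1 − z²)(1 − z⁴))`. -/
theorem trace_adjoint_principal_sp (n : ℕ) (hn : 1 ≤ n) (z : ℂ) (hz : z ≠ 0)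
    (hz4 : z ^ 4 ≠ 1) :
    ∃ φ : spSubmodule n →ₗ[ℂ] spSubmodule n,
      (∀ Y : spSubmodule n,
        (φ Y : Matrix (Fin n ⊕ Fin n) (Fin n ⊕ Fin n) ℂ) =
          Matrix.fromBlocks (principalDiagC n z) 0 0 (principalDiagC n z)⁻¹ *
            (Y : Matrix (Fin n ⊕ Fin n) (Fin n ⊕ Fin n) ℂ) *
            (Matrix.fromBlocks (principalDiagC n z) 0 0 (principalDiagC n z)⁻¹)⁻¹) ∧
      LinearMap.trace ℂ (spSubmodule n) φ =
        z ^ (-(4 * (n : ℤ) - 2)) *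
          ((1 - z ^ (4 * (n : ℤ))) * (1 - z ^ (4 * (n : ℤ) + 2))) /
            ((1 - z ^ 2) * (1 - z ^ 4)) := by
  have hmem (Y : Matrix (Fin n ⊕ Fin n) (Fin n ⊕ Fin n) ℂ) :
      (principalConj n z ∘ₗ spProjection n) Y ∈ spSubmodule n := by
    rw [LinearMap.comp_apply, principalConj_apply]
    exact diagonal_conj_mem_spSubmodule (spProjection_mem n Y)
  refine ⟨(principalConj n z ∘ₗ spProjection n).restrict fun Y _ => hmem Y, fun Y => ?_, ?_⟩
  · rw [fromBlocks_principalDiagC n hz,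
      Matrix.inv_diagonal_of_ne_zero (principalWeight_ne_zero n hz), LinearMap.coe_restrict_apply,
      LinearMap.comp_apply, spProjection_of_mem Y.2, principalConj_apply]
  · rw [LinearMap.trace_restrict_eq_of_forall_mem _ _ hmem,
      trace_principalConj_comp_spProjection, symmetricSquare_principalWeight n hz hz4]
end

section
/- Let A and B be finite sets of integers such that the map (a, b) ↦ a + b is injective on A × B and the map (a, b) ↦ a − b is injective on A × B. Let X = {a + b : a ∈ A, b ∈ B} and Y = {a − b : a ∈ A, b ∈ B} (finite sets of integers, each of cardinality |A|·|B|). Then the difference multisets of X and Y coincide: the multiset {x − x' : (x, x') ∈ X × X} equals the multiset {y − y' : (y, y') ∈ Y × Y}. -/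
/-- The multiset of differences of the image of `s` under a map injective on `s` can be computed
over pairs of elements of `s`. -/
theorem map_sub_image_product_image {α G : Type*} [DecidableEq α] [DecidableEq G] [Sub G]
    {s : Finset α} {f : α → G} (hf : Set.InjOn f s) :
    Multiset.map (fun p : G × G => p.1 - p.2) (s.image f ×ˢ s.image f).val =
      Multiset.map (fun q : α × α => f q.1 - f q.2) (s ×ˢ s).val := by
  have hinj : Set.InjOn (Prod.map f f) ↑(s ×ˢ s) := by
    rw [Finset.coe_product]
    exact hf.prodMap hf
  rw [← Finset.prodMap_image_product, Finset.image_val_of_injOn hinj, Multiset.map_map]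
  rfl

/-- The involution `((a, b), (a', b')) ↦ ((a, b'), (a', b))`. -/
def swapSnd (α β : Type*) : (α × β) × (α × β) ≃ (α × β) × (α × β) where
  toFun q := ((q.1.1, q.2.2), (q.2.1, q.1.2))
  invFun q := ((q.1.1, q.2.2), (q.2.1, q.1.2))
  left_inv _ := rfl
  right_inv _ := rfl

theorem map_swapSnd_product {α β : Type*} (A : Finset α) (B : Finset β) :
    ((A ×ˢ B) ×ˢ (A ×ˢ B)).map (swapSnd α β).toEmbedding = (A ×ˢ B) ×ˢ (A ×ˢ B) := by
  ext q
  rw [Finset.mem_map_equiv]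
  simp only [swapSnd, Equiv.coe_fn_symm_mk, Finset.mem_product]
  tauto

/-- if `A`, `B` are finite sets of integers on which `(a, b) ↦ a + b` and
`(a, b) ↦ a − b` are both injective, then the sumset `X = A + B` and the difference set
`Y = A − B` have equal difference multisets:
`{x − x' : (x, x') ∈ X × X} = {y − y' : (y, y') ∈ Y × Y}` as multisets. -/
theorem difference_multiset_sumset_eq (A B : Finset ℤ)
    (hadd : Set.InjOn (fun p : ℤ × ℤ => p.1 + p.2) ↑(A ×ˢ B))
    (hsub : Set.InjOn (fun p : ℤ × ℤ => p.1 - p.2) ↑(A ×ˢ B)) :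
    Multiset.map (fun p : ℤ × ℤ => p.1 - p.2)
        (((A ×ˢ B).image fun p : ℤ × ℤ => p.1 + p.2) ×ˢ
          ((A ×ˢ B).image fun p : ℤ × ℤ => p.1 + p.2)).val =
      Multiset.map (fun p : ℤ × ℤ => p.1 - p.2)
        (((A ×ˢ B).image fun p : ℤ × ℤ => p.1 - p.2) ×ˢ
          ((A ×ˢ B).image fun p : ℤ × ℤ => p.1 - p.2)).val := by
  rw [map_sub_image_product_image hadd, map_sub_image_product_image hsub]
  conv_lhs => rw [← map_swapSnd_product A B, Finset.map_val, Multiset.map_map]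
  refine Multiset.map_congr rfl fun q _ => ?_
  simp only [Function.comp_apply, Equiv.coe_toEmbedding, swapSnd, Equiv.coe_fn_mk]
  ring
end
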